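/- arXiv:2005.08534 — 4 statements merged into one kernel-verified Lean document; each statement's English description precedes it below -/
import Mathlib

section
/- Let 1 < β ≤ 2, M ≥ 2 an integer, μ₀ > 0, K > 0 and ν_β > 0. Then the matrix A = μ₀·I + K·ν_β·G_β (with I the (M−1)×(M−1) identity) is symmetric positive definite; in particular A is invertible, so for every b ∈ ℝ^{M−1} the linear system A·u = b has a unique solution. -/
/-- Fractional centered difference coefficients `ĝ_k^{(β)}`. -/
noncomputable def ghat (β : ℝ) (k : ℤ) : ℝ :=
  (-1 : ℝ) ^ k * Real.Gamma (β + 1) /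
    (Real.Gamma (β / 2 - k + 1) * Real.Gamma (β / 2 + k + 1))

/-- The `(M−1)×(M−1)` symmetric Toeplitz matrix `G_β`. -/
noncomputable def Gmat (β : ℝ) (M : ℕ) : Matrix (Fin (M - 1)) (Fin (M - 1)) ℝ :=
  Matrix.of fun i j => ghat β ((i : ℤ) - (j : ℤ))

/-- First column of the circulant approximation `r(G_β)`. -/
noncomputable def rcol (β : ℝ) (M : ℕ) (k : ℕ) : ℝ :=
  if k = 0 then ghat β 0 else ghat β k + ghat β ((k : ℤ) - ((M : ℤ) - 1))

/-- The `(M−1)×(M−1)` circulant matrix `r(G_β)`. -/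
noncomputable def circG (β : ℝ) (M : ℕ) : Matrix (Fin (M - 1)) (Fin (M - 1)) ℝ :=
  Matrix.of fun i j => rcol β M ((((i : ℤ) - (j : ℤ)) % ((M : ℤ) - 1)).toNat)

/-- The constant `c_*^{(β)} = (2/β) r_β`. -/
noncomputable def cstar (β : ℝ) : ℝ :=
  (2 / β) * (Real.exp (-2) * ((4 - β) * (2 - β) * β) / ((6 + β) * (4 + β) * (2 + β)) *
    (Real.Gamma (β + 1) / (Real.Gamma (β / 2 + 1)) ^ 2) * (3 + β / 2) ^ (β + 1))

/-- Grünwald coefficients `g_k^{(γ)}`. -/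
noncomputable def gcoef (γ : ℝ) : ℕ → ℝ
  | 0 => 1
  | (k + 1) => (1 - (γ + 1) / (k + 1)) * gcoef γ k

/-- Weighted and shifted Grünwald coefficients `λ_k^{(γ)}`. -/
noncomputable def lamc (γ : ℝ) : ℕ → ℝ
  | 0 => 1 + γ / 2
  | (k + 1) => (1 + γ / 2) * gcoef γ (k + 1) - (γ / 2) * gcoef γ k


lemma ghat_rec (β : ℝ) (k : ℤ) :
    (β / 2 + (k + 1 : ℤ)) * ghat β (k + 1) = (k - β / 2) * ghat β k := by
  unfold ghat
  have h1 : β / 2 - ((k + 1 : ℤ) : ℝ) + 1 = β / 2 - k := by push_cast; ring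
  have h2 : β / 2 + ((k + 1 : ℤ) : ℝ) + 1 = (β / 2 + k + 1) + 1 := by push_cast; ring
  have h3 : β / 2 + ((k + 1 : ℤ) : ℝ) = β / 2 + k + 1 := by push_cast; ring
  rw [h1, h2, h3, zpow_add_one₀ (by norm_num)]
  by_cases hb : β / 2 + k + 1 = 0
  · rw [hb]; simp [Real.Gamma_zero]
  rw [Real.Gamma_add_one hb]
  by_cases ha : β / 2 - k = 0
  · have ha' : (k : ℝ) - β / 2 = 0 := by linarith
    rw [ha, ha']; simp [Real.Gamma_zero]
  rw [Real.Gamma_add_one ha]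
  have e : (k : ℝ) - β / 2 = -(β / 2 - k) := by ring
  rw [e]
  generalize β / 2 - (k : ℝ) = x at *
  generalize β / 2 + (k : ℝ) + 1 = y at *
  by_cases hx : Real.Gamma x = 0
  · simp [hx]
  by_cases hy : Real.Gamma y = 0
  · simp [hy]
  field_simp

lemma ghat_neg (β : ℝ) (k : ℤ) : ghat β (-k) = ghat β k := by
  unfold ghat
  rw [zpow_neg, ← inv_zpow]
  have : (-1 : ℝ)⁻¹ = -1 := by norm_num
  rw [this]
  push_cast
  rw [sub_neg_eq_add, ← sub_eq_add_neg, mul_comm (Real.Gamma (β / 2 + k + 1))]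

lemma ghat_zero_pos (β : ℝ) (hβ : 0 < β) : 0 < ghat β 0 := by
  unfold ghat
  have h1 := Real.Gamma_pos_of_pos (show 0 < β + 1 by linarith)
  have h2 := Real.Gamma_pos_of_pos (show 0 < β / 2 + 1 by linarith)
  simp only [zpow_zero, Int.cast_zero, sub_zero, add_zero, one_mul]
  positivity

lemma ghat_succ_nonpos (β : ℝ) (h1 : 1 < β) (h2 : β ≤ 2) (n : ℕ) :
    ghat β ((n : ℤ) + 1) ≤ 0 := by
  induction n with
  | zero =>
    have h := ghat_rec β 0
    have h0 := ghat_zero_pos β (by linarith)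
    push_cast at h ⊢
    have : 0 < β * ghat β 0 := by positivity
    by_contra hc
    push Not at hc
    have : 0 < (β / 2 + (0 + 1)) * ghat β (0 + 1) := by positivity
    nlinarith
  | succ n ih =>
    have h := ghat_rec β (n + 1)
    push_cast at h ⊢
    have hn : (0 : ℝ) ≤ n := by positivity
    have : ((n : ℝ) + 1 - β / 2) * ghat β (n + 1) ≤ 0 :=
      mul_nonpos_of_nonneg_of_nonpos (by linarith) ih
    by_contra hc
    push Not at hc
    have : 0 < (β / 2 + (n + 1 + 1)) * ghat β (n + 1 + 1) := by positivity
    linarith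

lemma ghat_nonpos (β : ℝ) (h1 : 1 < β) (h2 : β ≤ 2) (k : ℤ) (hk : k ≠ 0) :
    ghat β k ≤ 0 := by
  have pos : ∀ k : ℤ, 0 < k → ghat β k ≤ 0 := by
    intro k hk
    have := ghat_succ_nonpos β h1 h2 (k - 1).toNat
    have e : (((k - 1).toNat : ℕ) : ℤ) + 1 = k := by omega
    rwa [e] at this
  rcases lt_or_gt_of_ne hk with h | h
  · rw [← ghat_neg]; exact pos _ (by omega)
  · exact pos _ h

lemma ghat_sum (β : ℝ) (i : ℤ) (n : ℕ) :
    β * ∑ j ∈ Finset.range n, ghat β ((j : ℤ) - i) =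
      (β / 2 - i) * ghat β (-i) - (β / 2 + n - i) * ghat β (n - i) := by
  induction n with
  | zero => simp
  | succ n ih =>
    have h := ghat_rec β (n - i)
    have e : ((n + 1 : ℕ) : ℤ) - i = n - i + 1 := by push_cast; ring
    rw [Finset.sum_range_succ, mul_add, ih, e]
    push_cast at h ⊢
    linear_combination h

lemma ghat_row (β : ℝ) (h1 : 1 < β) (h2 : β ≤ 2) (n : ℕ) (i : Fin n) :
    0 ≤ ∑ j : Fin n, ghat β ((i : ℤ) - (j : ℤ)) := by
  have e : ∑ j : Fin n, ghat β ((i : ℤ) - (j : ℤ)) =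
      ∑ j ∈ Finset.range n, ghat β ((j : ℤ) - (i : ℤ)) := by
    rw [← Fin.sum_univ_eq_sum_range (fun j => ghat β ((j : ℤ) - (i : ℤ)))]
    refine Finset.sum_congr rfl fun j _ => ?_
    rw [← ghat_neg, neg_sub]
  have h := ghat_sum β i n
  rw [e]
  have hi : ((i : ℕ) : ℝ) + 1 ≤ n := by exact_mod_cast i.2
  have t2 : (β / 2 + n - ((i : ℕ) : ℤ)) * ghat β (n - ((i : ℕ) : ℤ)) ≤ 0 := by
    refine mul_nonpos_of_nonneg_of_nonpos ?_ (ghat_nonpos β h1 h2 _ (by omega))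
    push_cast
    linarith
  have t1 : 0 ≤ (β / 2 - ((i : ℕ) : ℤ)) * ghat β (-((i : ℕ) : ℤ)) := by
    rcases Nat.eq_zero_or_pos (i : ℕ) with h0 | h0
    · have := ghat_zero_pos β (by linarith)
      rw [h0]
      simp only [Nat.cast_zero, Int.cast_zero, sub_zero, neg_zero]
      positivity
    · refine mul_nonneg_of_nonpos_of_nonpos ?_ (ghat_nonpos β h1 h2 _ (by omega))
      have : (1 : ℝ) ≤ (i : ℕ) := by exact_mod_cast h0
      push_cast
      linarith
  have : 0 ≤ β * ∑ j ∈ Finset.range n, ghat β ((j : ℤ) - (i : ℤ)) := by linarith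
  exact nonneg_of_mul_nonneg_right this (by linarith)

lemma Gmat_symm (β : ℝ) (M : ℕ) : (Gmat β M).IsSymm := by
  ext i j
  simp only [Gmat, Matrix.transpose_apply, Matrix.of_apply]
  rw [← ghat_neg, neg_sub]

open scoped Matrix in
lemma Gmat_psd (β : ℝ) (h1 : 1 < β) (h2 : β ≤ 2) (M : ℕ) : (Gmat β M).PosSemidef := by
  refine Matrix.PosSemidef.of_dotProduct_mulVec_nonneg ?_ ?_
  · rw [Matrix.IsHermitian, Matrix.conjTranspose_eq_transpose_of_trivial]
    exact Gmat_symm β M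
  intro x
  have hs : ∀ i j, Gmat β M i j = Gmat β M j i := fun i j => (Gmat_symm β M).apply j i
  have key : star x ⬝ᵥ (Gmat β M).mulVec x =
      ∑ i, (∑ j, Gmat β M i j) * x i ^ 2 +
        1 / 2 * ∑ i, ∑ j, (-Gmat β M i j) * (x i - x j) ^ 2 := by
    have e1 : ∑ i, ∑ j, Gmat β M i j * x j ^ 2 = ∑ i, ∑ j, Gmat β M i j * x i ^ 2 := by
      rw [Finset.sum_comm]
      refine Finset.sum_congr rfl fun i _ => Finset.sum_congr rfl fun j _ => ?_
      rw [hs]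
    have e2 : ∑ i, ∑ j, (-Gmat β M i j) * (x i - x j) ^ 2 =
        2 * ∑ i, ∑ j, x i * (Gmat β M i j * x j) - ∑ i, ∑ j, Gmat β M i j * x i ^ 2
          - ∑ i, ∑ j, Gmat β M i j * x j ^ 2 := by
      simp only [Finset.mul_sum, ← Finset.sum_sub_distrib]
      refine Finset.sum_congr rfl fun i _ => Finset.sum_congr rfl fun j _ => ?_
      ring
    simp only [dotProduct, Matrix.mulVec, star_trivial, Finset.sum_mul]
    rw [e2, e1]
    simp only [Finset.mul_sum]
    ring_nf
    simp only [Finset.sum_mul]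
    ring_nf
  rw [key]
  refine add_nonneg (Finset.sum_nonneg fun i _ => mul_nonneg ?_ (sq_nonneg _))
    (mul_nonneg (by norm_num) (Finset.sum_nonneg fun i _ => Finset.sum_nonneg fun j _ => ?_))
  · exact ghat_row β h1 h2 _ i
  · by_cases hij : i = j
    · simp [hij]
    · refine mul_nonneg (neg_nonneg.2 (ghat_nonpos β h1 h2 _ ?_)) (sq_nonneg _)
      intro h
      exact hij (Fin.ext (by omega))

/-- `A = μ₀ I + K ν_β G_β` is symmetric positive definite; in particular
for every `b` the system `A u = b` has a unique solution. -/
theorem stmt0 (β : ℝ) (hβ1 : 1 < β) (hβ2 : β ≤ 2) (M : ℕ) (hM : 2 ≤ M)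
    (μ₀ K νβ : ℝ) (hμ : 0 < μ₀) (hK : 0 < K) (hν : 0 < νβ) :
    let A : Matrix (Fin (M - 1)) (Fin (M - 1)) ℝ :=
      μ₀ • (1 : Matrix (Fin (M - 1)) (Fin (M - 1)) ℝ) + (K * νβ) • Gmat β M
    A.IsSymm ∧ A.PosDef ∧ ∀ b : Fin (M - 1) → ℝ, ∃! u, A.mulVec u = b := by
  intro A
  have hA : A.PosDef := by
    refine Matrix.PosDef.add_posSemidef ?_ ?_
    · exact Matrix.PosDef.one.smul hμ
    · exact (Gmat_psd β hβ1 hβ2 M).smul (by positivity)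
  refine ⟨?_, hA, ?_⟩
  · have := hA.isHermitian
    rwa [Matrix.IsHermitian, Matrix.conjTranspose_eq_transpose_of_trivial] at this
  · intro b
    have hu : IsUnit A := hA.isUnit
    exact (Function.bijective_iff_existsUnique _).1
      ⟨Matrix.mulVec_injective_iff_isUnit.2 hu, Matrix.mulVec_surjective_iff_isUnit.2 hu⟩ b
end

section
/- Let 1 < β ≤ 2. Then ĝ₀^{(β)} = Γ(β+1)/Γ(β/2+1)² ≥ 0, and for every integer k ≥ 1 one has ĝ_{−k}^{(β)} = ĝ_k^{(β)} and ĝ_k^{(β)} ≤ 0. -/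
theorem gamma_sign_aux (x : ℝ) (h0 : 0 < x) (h1 : x ≤ 1) (n : ℕ) :
    0 ≤ (-1 : ℝ) ^ n * Real.Gamma (x - n) := by
  induction n with
  | zero => simpa using (Real.Gamma_pos_of_pos h0).le
  | succ n ih =>
    by_cases hs : x - ((n + 1 : ℕ) : ℝ) = 0
    · rw [hs]; simp
    · have h := Real.Gamma_add_one hs
      have e : x - ((n + 1 : ℕ) : ℝ) + 1 = x - n := by push_cast; ring
      rw [e] at h
      rw [h] at ih
      have hneg : x - ((n + 1 : ℕ) : ℝ) < 0 := by
        refine lt_of_le_of_ne ?_ hs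
        have : (0 : ℝ) ≤ n := Nat.cast_nonneg n
        push_cast; linarith
      rw [pow_succ]
      by_contra hc
      push Not at hc
      nlinarith

/-- `ĝ₀^{(β)} = Γ(β+1)/Γ(β/2+1)² ≥ 0`, and for `k ≥ 1`,
`ĝ_{−k}^{(β)} = ĝ_k^{(β)} ≤ 0`. -/
theorem stmt10 (β : ℝ) (hβ1 : 1 < β) (hβ2 : β ≤ 2) :
    ghat β 0 = Real.Gamma (β + 1) / (Real.Gamma (β / 2 + 1)) ^ 2 ∧
    0 ≤ ghat β 0 ∧
    ∀ k : ℕ, 1 ≤ k → ghat β (-(k : ℤ)) = ghat β (k : ℤ) ∧ ghat β (k : ℤ) ≤ 0 := by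
  have hA : 0 < Real.Gamma (β + 1) := Real.Gamma_pos_of_pos (by linarith)
  have e0 : ghat β 0 = Real.Gamma (β + 1) / (Real.Gamma (β / 2 + 1)) ^ 2 := by
    simp [ghat, sq]
  refine ⟨e0, ?_, ?_⟩
  · rw [e0]; positivity
  · intro k hk
    constructor
    · unfold ghat
      rw [zpow_neg, ← inv_zpow]
      push_cast
      rw [sub_neg_eq_add, ← sub_eq_add_neg, mul_comm (Real.Gamma (β / 2 + k + 1))]
      norm_num
    · obtain ⟨n, rfl⟩ : ∃ n, k = n + 1 := ⟨k - 1, by omega⟩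
      have hP := gamma_sign_aux (β / 2) (by linarith) (by linarith) n
      have hB : 0 < Real.Gamma (β / 2 + ((n + 1 : ℕ) : ℝ) + 1) :=
        Real.Gamma_pos_of_pos (by positivity)
      have e : β / 2 - ((n + 1 : ℕ) : ℝ) + 1 = β / 2 - n := by push_cast; ring
      unfold ghat
      rw [zpow_natCast, Int.cast_natCast, e, pow_succ]
      rcases neg_one_pow_eq_or ℝ n with h | h
      · rw [h] at hP ⊢
        apply div_nonpos_of_nonpos_of_nonneg
        · linarith
        · exact mul_nonneg (by linarith) hB.le
      · rw [h] at hP ⊢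
        apply div_nonpos_of_nonneg_of_nonpos
        · linarith
        · exact mul_nonpos_of_nonpos_of_nonneg (by linarith) hB.le
end

section
/- Let γ ∈ [0,1]. Then the weighted-shifted Grünwald coefficients satisfy: λ₀^{(γ)} = 1 + γ/2 > 0; λ₁^{(γ)} = −(1/2)·(γ+3)·γ ≤ 0; λ₂^{(γ)} = (1/4)·(γ² + 3γ − 2)·γ, which is ≤ 0 for γ ∈ [0, (√17 − 3)/2] and > 0 for γ ∈ ((√17 − 3)/2, 1]; and λ_k^{(γ)} = [(1 + γ/2)·(1 − (1+γ)/k) − γ/2]·g_{k−1}^{(γ)} ≤ 0 for every integer k ≥ 3. -/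
theorem gcoef_nonpos_aux (γ : ℝ) (hγ0 : 0 ≤ γ) (hγ1 : γ ≤ 1) (n : ℕ) : gcoef γ (n + 1) ≤ 0 := by
  induction n with
  | zero => simp [gcoef]; exact hγ0
  | succ n ih =>
    rw [gcoef]
    apply mul_nonpos_of_nonneg_of_nonpos _ ih
    rw [sub_nonneg, div_le_one (by positivity)]
    push_cast
    have : (0 : ℝ) ≤ n := n.cast_nonneg
    linarith

/-- sign properties of the weighted-shifted Grünwald coefficients `λ_k^{(γ)}`. -/
theorem stmt14 (γ : ℝ) (hγ0 : 0 ≤ γ) (hγ1 : γ ≤ 1) :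
    lamc γ 0 = 1 + γ / 2 ∧ 0 < lamc γ 0 ∧
    lamc γ 1 = -(1 / 2) * (γ + 3) * γ ∧ lamc γ 1 ≤ 0 ∧
    lamc γ 2 = (1 / 4) * (γ ^ 2 + 3 * γ - 2) * γ ∧
    (γ ≤ (Real.sqrt 17 - 3) / 2 → lamc γ 2 ≤ 0) ∧
    ((Real.sqrt 17 - 3) / 2 < γ → 0 < lamc γ 2) ∧
    ∀ k : ℕ, 3 ≤ k →
      lamc γ k = ((1 + γ / 2) * (1 - (1 + γ) / k) - γ / 2) * gcoef γ (k - 1) ∧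
      lamc γ k ≤ 0 := by
  have h1 : lamc γ 1 = -(1 / 2) * (γ + 3) * γ := by
    simp [lamc, gcoef]; ring
  have h2 : lamc γ 2 = (1 / 4) * (γ ^ 2 + 3 * γ - 2) * γ := by
    simp [lamc, gcoef]; ring
  have hs : Real.sqrt 17 ^ 2 = 17 := Real.sq_sqrt (by norm_num)
  have hs0 : 0 ≤ Real.sqrt 17 := Real.sqrt_nonneg 17
  have hs3 : 3 < Real.sqrt 17 := by
    rw [Real.lt_sqrt] <;> norm_num
  refine ⟨rfl, ?_, h1, ?_, h2, ?_, ?_, ?_⟩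
  · show 0 < 1 + γ / 2
    linarith
  · rw [h1]; nlinarith
  · intro h
    rw [h2]
    apply mul_nonpos_of_nonpos_of_nonneg _ hγ0
    nlinarith
  · intro h
    rw [h2]
    apply mul_pos _ (by linarith)
    nlinarith
  · intro k hk
    obtain ⟨n, rfl⟩ : ∃ n, k = n + 3 := ⟨k - 3, by omega⟩
    have e : lamc γ (n + 3) = ((1 + γ / 2) * (1 - (1 + γ) / ((n + 3 : ℕ) : ℝ)) - γ / 2)
        * gcoef γ (n + 3 - 1) := by
      show (1 + γ / 2) * ((1 - (γ + 1) / (((n + 2 : ℕ) : ℝ) + 1)) * gcoef γ (n + 2))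
        - (γ / 2) * gcoef γ (n + 2) = _
      have : ((n + 2 : ℕ) : ℝ) + 1 = ((n + 3 : ℕ) : ℝ) := by push_cast; ring
      rw [this, show n + 3 - 1 = n + 2 from rfl]
      ring
    refine ⟨e, ?_⟩
    rw [e]
    apply mul_nonpos_of_nonneg_of_nonpos _ (gcoef_nonpos_aux γ hγ0 hγ1 (n + 1))
    have hn : (0 : ℝ) ≤ n := n.cast_nonneg
    have hp : (0 : ℝ) < ((n + 3 : ℕ) : ℝ) := by positivity
    have : (1 + γ / 2) * (1 - (1 + γ) / ((n + 3 : ℕ) : ℝ)) - γ / 2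
        = (((n + 3 : ℕ) : ℝ) - (1 + γ / 2) * (1 + γ)) / ((n + 3 : ℕ) : ℝ) := by
      field_simp
      ring
    rw [this]
    apply div_nonneg _ hp.le
    push_cast
    nlinarith
end

section
/- Let 1 < β ≤ 2, L > 0, let M ≥ 2 be an integer and set h = L/M. Then for every v ∈ ℝ^{M−1}, the quadratic form of the scaled Toeplitz matrix satisfies vᵀ·(h^{−β}·G_β)·v ≥ (c_*^{(β)}/L^β)·‖v‖₂², i.e. the smallest eigenvalue of h^{−β}·G_β is at least c_*^{(β)}/L^β. -/
lemma inv_Gamma_step (s : ℝ) : (Real.Gamma s)⁻¹ = s * (Real.Gamma (s + 1))⁻¹ := by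
  by_cases hs : s = 0
  · simp [hs]
  · rw [Real.Gamma_add_one hs, mul_inv, ← mul_assoc, mul_inv_cancel₀ hs, one_mul]

lemma ghat_succ (β : ℝ) (hβ : 0 < β) (k : ℕ) :
    ghat β ((k : ℤ) + 1) * (k + 1 + β / 2) = ghat β k * (k - β / 2) := by
  unfold ghat
  have h1 := inv_Gamma_step (β / 2 - k)
  have h2 := inv_Gamma_step (β / 2 + k + 1)
  push_cast
  rw [show β / 2 - ((k : ℝ) + 1) + 1 = β / 2 - k by ring,
    show β / 2 + ((k : ℝ) + 1) + 1 = β / 2 + k + 1 + 1 by ring,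
    div_eq_mul_inv _ (_ * _), div_eq_mul_inv _ (_ * _), mul_inv, mul_inv, h1, h2,
    zpow_add₀ (by norm_num)]
  simp only [zpow_one]
  ring

/-- Tail sums. -/
noncomputable def tl (β : ℝ) (m : ℕ) : ℝ := - ghat β m * (m + β / 2) / β

lemma tl_succ (β : ℝ) (hβ : 0 < β) (m : ℕ) :
    tl β (m + 1) * (m + β / 2) = tl β m * (m - β / 2) := by
  have := ghat_succ β hβ m
  unfold tl
  push_cast
  rw [show -ghat β ((m : ℤ) + 1) * ((m : ℝ) + 1 + β / 2) / β
    = -(ghat β ((m : ℤ) + 1) * ((m : ℝ) + 1 + β / 2)) / β by ring, this]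
  ring

lemma tl_sub (β : ℝ) (hβ : 0 < β) (m : ℕ) : tl β (m + 1) = tl β m + ghat β m := by
  have := ghat_succ β hβ m
  unfold tl
  push_cast
  rw [show -ghat β ((m : ℤ) + 1) * ((m : ℝ) + 1 + β / 2) / β
    = -(ghat β ((m : ℤ) + 1) * ((m : ℝ) + 1 + β / 2)) / β by ring, this]
  field_simp
  ring

lemma tl_zero (β : ℝ) (hβ : 0 < β) : tl β 0 = - ghat β 0 / 2 := by
  unfold tl
  push_cast
  field_simp
  ring

lemma tl_nonneg (β : ℝ) (hβ : 0 < β) (hβ2 : β ≤ 2) (m : ℕ) : 0 ≤ tl β (m + 1) := by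
  induction m with
  | zero =>
    rw [tl_sub β hβ, tl_zero β hβ]
    have := ghat_zero_pos β hβ
    push_cast
    linarith
  | succ m ih =>
    have h := tl_succ β hβ (m + 1)
    have hm : (0 : ℝ) ≤ m := Nat.cast_nonneg m
    push_cast at h
    have h2 : 0 ≤ tl β (m + 1) * ((m : ℝ) + 1 - β / 2) := mul_nonneg ih (by linarith)
    rw [← h] at h2
    exact nonneg_of_mul_nonneg_left h2 (by linarith)

lemma ghat_nonpos_s17 (β : ℝ) (hβ : 0 < β) (hβ2 : β ≤ 2) (m : ℕ) : ghat β ((m : ℤ) + 1) ≤ 0 := by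
  have h := tl_nonneg β hβ hβ2 m
  unfold tl at h
  by_contra hc
  push Not at hc
  have hm : (0 : ℝ) ≤ m := Nat.cast_nonneg m
  have : - ghat β ((m : ℤ) + 1) * ((m : ℝ) + 1 + β / 2) / β < 0 := by
    apply div_neg_of_neg_of_pos _ hβ
    have : 0 < ghat β ((m : ℤ) + 1) * ((m : ℝ) + 1 + β / 2) := by positivity
    linarith
  push_cast at h
  linarith

lemma tl_anti (β : ℝ) (hβ : 0 < β) (hβ2 : β ≤ 2) (m : ℕ) : tl β (m + 1 + 1) ≤ tl β (m + 1) := by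
  have := ghat_nonpos_s17 β hβ hβ2 m
  rw [tl_sub β hβ (m + 1)]
  push_cast
  linarith

lemma ghat_off (β : ℝ) (hβ : 0 < β) (hβ2 : β ≤ 2) (k : ℤ) (hk : k ≠ 0) : ghat β k ≤ 0 := by
  rcases lt_or_gt_of_ne hk with h | h
  · obtain ⟨m, hm⟩ := Int.eq_ofNat_of_zero_le (show 0 ≤ -k - 1 by omega)
    rw [← ghat_neg, show -k = (m : ℤ) + 1 by omega]
    exact ghat_nonpos_s17 β hβ hβ2 m
  · obtain ⟨m, hm⟩ := Int.eq_ofNat_of_zero_le (show 0 ≤ k - 1 by omega)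
    rw [show k = (m : ℤ) + 1 by omega]
    exact ghat_nonpos_s17 β hβ hβ2 m

lemma sum_ghat (β : ℝ) (hβ : 0 < β) (m : ℕ) :
    ∑ k ∈ Finset.range m, ghat β k = tl β m + ghat β 0 / 2 := by
  induction m with
  | zero => simp [tl_zero β hβ]; ring
  | succ m ih => rw [Finset.sum_range_succ, ih, tl_sub β hβ]; ring

lemma row_sum (β : ℝ) (hβ : 0 < β) (i q : ℕ) :
    ∑ j ∈ Finset.range (i + 1 + q), ghat β ((i : ℤ) - j) = tl β (i + 1) + tl β (q + 1) := by
  rw [Finset.sum_range_add]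
  have h1 : ∑ j ∈ Finset.range (i + 1), ghat β ((i : ℤ) - j)
      = ∑ k ∈ Finset.range (i + 1), ghat β k := by
    rw [← Finset.sum_range_reflect (fun k : ℕ => ghat β k)]
    apply Finset.sum_congr rfl
    intro j hj
    rw [Finset.mem_range] at hj
    congr 1
    omega
  have h2 : ∑ j ∈ Finset.range q, ghat β ((i : ℤ) - ((i + 1 + j : ℕ) : ℤ))
      = tl β (q + 1) - ghat β 0 / 2 := by
    have := sum_ghat β hβ (q + 1)
    rw [Finset.sum_range_succ'] at this
    have h3 : ∑ j ∈ Finset.range q, ghat β ((i : ℤ) - ((i + 1 + j : ℕ) : ℤ))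
      = ∑ j ∈ Finset.range q, ghat β ((j + 1 : ℕ) : ℤ) := by
      apply Finset.sum_congr rfl
      intro j _
      rw [← ghat_neg]
      congr 1
      push_cast
      ring
    rw [h3]
    push_cast at this ⊢
    linarith
  rw [h1, h2, sum_ghat β hβ]
  ring

lemma tl_grow (β : ℝ) (hβ : 1 < β) (hβ2 : β ≤ 2) (m : ℕ) :
    tl β 3 * (3 - β / 2) ^ β ≤ tl β (m + 3) * ((m : ℝ) + 3 - β / 2) ^ β := by
  induction m with
  | zero => simp
  | succ m ih =>
    refine ih.trans ?_
    have hm : (0 : ℝ) ≤ m := Nat.cast_nonneg m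
    have h := tl_succ β (by linarith) (m + 3)
    push_cast at h ⊢
    have ht := tl_nonneg β (by linarith) hβ2 (m + 2)
    set x : ℝ := (m : ℝ) + 3 - β / 2 with hx
    have hx0 : 0 < x := by linarith
    have hb : 1 + β * (1 / x) ≤ (1 + 1 / x) ^ β :=
      one_add_mul_self_le_rpow_one_add (by have : 0 < 1 / x := by positivity
                                           linarith) hβ.le
    have he : (m : ℝ) + 1 + 3 - β / 2 = x * (1 + 1 / x) := by
      field_simp; rw [hx]; ring
    have he2 : (m : ℝ) + 3 + β / 2 = x + β := by rw [hx]; ring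
    rw [he2] at h
    have hT : tl β (m + 1 + 3) = tl β (m + 3) * x / (x + β) := by
      rw [eq_div_iff (by linarith), ← h]
    rw [he, Real.mul_rpow hx0.le (by positivity), hT]
    have hp : 0 ≤ tl β (m + 3) * x ^ β := mul_nonneg ht (by positivity)
    have hk : 1 ≤ x / (x + β) * (1 + 1 / x) ^ β := by
      calc (1 : ℝ) = x / (x + β) * (1 + β * (1 / x)) := by
            have : x + β ≠ 0 := by linarith
            field_simp
        _ ≤ _ := by gcongr
    calc tl β (m + 3) * x ^ β = tl β (m + 3) * x ^ β * 1 := by ring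
      _ ≤ tl β (m + 3) * x ^ β * (x / (x + β) * (1 + 1 / x) ^ β) := by gcongr
      _ = _ := by ring

lemma cstar_eq (β : ℝ) (hβ : 0 < β) :
    cstar β = 2 * Real.exp (-2) * tl β 3 * (3 + β / 2) ^ β := by
  have e0 : ghat β 0 = Real.Gamma (β + 1) / (Real.Gamma (β / 2 + 1)) ^ 2 := by
    unfold ghat; simp [sq]
  have t1 := tl_sub β hβ 0
  rw [tl_zero β hβ] at t1
  have t2 := tl_succ β hβ 1
  have t3 := tl_succ β hβ 2
  norm_num at t1 t2 t3
  unfold cstar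
  rw [← e0, Real.rpow_add_one (by positivity)]
  have t2' : tl β 2 = tl β 1 * (1 - β / 2) / (1 + β / 2) := by
    rw [eq_div_iff (by positivity), t2]
  have t3' : tl β 3 = tl β 2 * (2 - β / 2) / (2 + β / 2) := by
    rw [eq_div_iff (by positivity), t3]
  rw [t3', t2', t1]
  field_simp
  ring

lemma tl_bound (β : ℝ) (hβ : 1 < β) (hβ2 : β ≤ 2) (M a : ℕ) (hM : 2 ≤ M) (ha : a + 1 ≤ M) :
    cstar β / 2 ≤ (M : ℝ) ^ β * tl β (a + 1) := by
  have hβ0 : 0 < β := by linarith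
  rw [cstar_eq β hβ0]
  have ht3 := tl_nonneg β hβ0 hβ2 2
  have hM' : (2 : ℝ) ≤ M := by exact_mod_cast hM
  have he1 : (2 : ℝ) ≤ Real.exp 1 := by have := Real.add_one_le_exp (1 : ℝ); linarith
  -- exp(-2) ≤ (1/2)^β
  have hexp : Real.exp (-2) ≤ (1 / 2 : ℝ) ^ β := by
    calc Real.exp (-2) = (Real.exp 1)⁻¹ ^ (2 : ℝ) := by
          rw [← Real.exp_neg, ← Real.exp_mul]; norm_num
      _ ≤ (1 / 2 : ℝ) ^ (2 : ℝ) := by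
          apply Real.rpow_le_rpow (by positivity) _ (by norm_num)
          rw [one_div]; gcongr
      _ ≤ (1 / 2 : ℝ) ^ β := Real.rpow_le_rpow_of_exponent_ge (by norm_num) (by norm_num) hβ2
  have hcomb : Real.exp (-2) * (3 + β / 2) ^ β ≤ ((3 + β / 2) / 2) ^ β := by
    rw [show (3 + β / 2) / 2 = (1 / 2) * (3 + β / 2) by ring,
      Real.mul_rpow (by norm_num) (by positivity)]
    gcongr
  rcases Nat.lt_or_ge a 2 with h | h
  · have h3 : tl β 3 ≤ tl β (a + 1) := by
      have h1 := tl_anti β hβ0 hβ2 0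
      have h2 := tl_anti β hβ0 hβ2 1
      interval_cases a
      · exact h2.trans h1
      · exact h2
    have : ((3 + β / 2) / 2) ^ β ≤ (M : ℝ) ^ β :=
      Real.rpow_le_rpow (by positivity) (by linarith) hβ0.le
    calc _ = tl β 3 * (Real.exp (-2) * (3 + β / 2) ^ β) := by ring
      _ ≤ tl β 3 * (M : ℝ) ^ β := mul_le_mul_of_nonneg_left (hcomb.trans this) ht3
      _ ≤ tl β (a + 1) * (M : ℝ) ^ β := by gcongr
      _ = _ := by ring
  · obtain ⟨m, rfl⟩ := Nat.exists_eq_add_of_le' h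
    have hg := tl_grow β hβ hβ2 m
    have hMa : (m : ℝ) + 3 ≤ M := by exact_mod_cast ha
    have hm : (0 : ℝ) ≤ m := Nat.cast_nonneg m
    have htm := tl_nonneg β hβ0 hβ2 (m + 2)
    have hA : ((m : ℝ) + 3 - β / 2) ^ β ≤ (M : ℝ) ^ β :=
      Real.rpow_le_rpow (by linarith) (by linarith) hβ0.le
    have : ((3 + β / 2) / 2) ^ β ≤ (3 - β / 2) ^ β :=
      Real.rpow_le_rpow (by positivity) (by linarith) hβ0.le
    calc _ = tl β 3 * (Real.exp (-2) * (3 + β / 2) ^ β) := by ring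
      _ ≤ tl β 3 * (3 - β / 2) ^ β := mul_le_mul_of_nonneg_left (hcomb.trans this) ht3
      _ ≤ _ := hg
      _ ≤ tl β (m + 3) * (M : ℝ) ^ β := mul_le_mul_of_nonneg_left hA htm
      _ = _ := by ring

open Matrix in
lemma quad_bound (β : ℝ) (hβ : 1 < β) (hβ2 : β ≤ 2) (M : ℕ) (hM : 2 ≤ M)
    (v : Fin (M - 1) → ℝ) :
    cstar β * ∑ i, v i ^ 2 ≤ (M : ℝ) ^ β * (v ⬝ᵥ (Gmat β M).mulVec v) := by
  have hβ0 : 0 < β := by linarith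
  have hrow : ∀ i : Fin (M - 1), cstar β ≤ (M : ℝ) ^ β * ∑ j, Gmat β M i j := by
    intro i
    have hi := i.2
    obtain ⟨q, hq⟩ := Nat.exists_eq_add_of_le (show (i : ℕ) + 1 ≤ M - 1 by omega)
    have : ∑ j, Gmat β M i j = tl β (i + 1) + tl β (q + 1) := by
      rw [← row_sum β hβ0, ← hq,
        ← Fin.sum_univ_eq_sum_range (fun j : ℕ => ghat β (((i : ℕ) : ℤ) - (j : ℤ)))]
      rfl
    rw [this, mul_add]
    have h1 := tl_bound β hβ hβ2 M i hM (by omega)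
    have h2 := tl_bound β hβ hβ2 M q hM (by omega)
    linarith
  have hsymm : ∀ i j, Gmat β M i j = Gmat β M j i := by
    intro i j
    simp only [Gmat, Matrix.of_apply]
    rw [← ghat_neg]
    congr 1
    ring
  have hpt : ∀ i j, Gmat β M i j * ((v i ^ 2 + v j ^ 2) / 2) ≤ v i * (Gmat β M i j * v j) := by
    intro i j
    by_cases hij : i = j
    · subst hij
      apply le_of_eq
      ring
    · have : Gmat β M i j ≤ 0 := by
        apply ghat_off β hβ0 hβ2
        intro h
        apply hij
        ext
        omega
      nlinarith [mul_nonneg (neg_nonneg.mpr this) (sq_nonneg (v i - v j))]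
  have hsum : ∑ i, (∑ j, Gmat β M i j) * v i ^ 2 ≤ v ⬝ᵥ (Gmat β M).mulVec v := by
    calc ∑ i, (∑ j, Gmat β M i j) * v i ^ 2
        = ∑ i, ∑ j, Gmat β M i j * ((v i ^ 2 + v j ^ 2) / 2) := by
          have e1 : ∑ i, ∑ j, Gmat β M i j * ((v i ^ 2 + v j ^ 2) / 2)
            = (∑ i, ∑ j, Gmat β M i j * v i ^ 2) / 2
              + (∑ i, ∑ j, Gmat β M i j * v j ^ 2) / 2 := by
            simp only [Finset.sum_div, ← Finset.sum_add_distrib]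
            refine Finset.sum_congr rfl fun i _ => Finset.sum_congr rfl fun j _ => by ring
          have e2 : ∑ i, ∑ j, Gmat β M i j * v j ^ 2 = ∑ i, ∑ j, Gmat β M i j * v i ^ 2 := by
            rw [Finset.sum_comm]
            refine Finset.sum_congr rfl fun i _ => Finset.sum_congr rfl fun j _ => by
              rw [hsymm]
          rw [e1, e2]
          simp only [Finset.sum_mul]
          ring
      _ ≤ ∑ i, ∑ j, v i * (Gmat β M i j * v j) :=
          Finset.sum_le_sum fun i _ => Finset.sum_le_sum fun j _ => hpt i j
      _ = _ := by simp only [dotProduct, Matrix.mulVec, Finset.mul_sum]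
  calc cstar β * ∑ i, v i ^ 2
      ≤ (M : ℝ) ^ β * ∑ i, (∑ j, Gmat β M i j) * v i ^ 2 := by
        rw [Finset.mul_sum, Finset.mul_sum]
        refine Finset.sum_le_sum fun i _ => ?_
        rw [← mul_assoc]
        exact mul_le_mul_of_nonneg_right (hrow i) (sq_nonneg _)
    _ ≤ _ := by gcongr

open Matrix in
/-- the quadratic form of `h^{−β} G_β` is bounded below:
`vᵀ (h^{−β} G_β) v ≥ (c_*^{(β)}/L^β) ‖v‖₂²`. -/
theorem stmt17 (β L : ℝ) (hβ1 : 1 < β) (hβ2 : β ≤ 2) (hL : 0 < L)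
    (M : ℕ) (hM : 2 ≤ M) (h : ℝ) (hh : h = L / M) :
    ∀ v : Fin (M - 1) → ℝ,
      cstar β / L ^ β * ∑ i, v i ^ 2 ≤ v ⬝ᵥ ((h ^ (-β)) • Gmat β M).mulVec v := by
  intro v
  have hq := quad_bound β hβ1 hβ2 M hM v
  have hLp : 0 < L ^ β := Real.rpow_pos_of_pos hL β
  have hh' : h ^ (-β) = (M : ℝ) ^ β / L ^ β := by
    rw [hh, Real.rpow_neg (by positivity), Real.div_rpow hL.le (by positivity), inv_div]
  rw [Matrix.smul_mulVec, dotProduct_smul, smul_eq_mul, hh', div_mul_eq_mul_div,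
    div_mul_eq_mul_div]
  gcongr
end
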